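/- Let n ≥ 2 and let f ∈ ℂ[x₁,…,xₙ] be a non-constant polynomial with f(0) = 0 which is convenient and non-degenerate at 0. Then there exists an open neighborhood U of 0 in ℂⁿ such that the hypersurface V = {x ∈ ℂⁿ : f(x) = 0} has no singular point in U ∖ {0}; in other words, 0 is either a smooth point or an isolated singular point of V. -/

import Mathlib

open MvPolynomial

noncomputable section

/-- The exponent vector of a monomial, regarded as a point of `ℝⁿ`. -/
def expR {n : ℕ} (α : Fin n →₀ ℕ) : Fin n → ℝ := fun i => (α i : ℝ)

/-- The convex hull of the union, over `α ∈ s`, of the translates `α + ℝ₊ⁿ` of the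
nonnegative orthant. -/
def newtonRegion {n : ℕ} (s : Set (Fin n →₀ ℕ)) : Set (Fin n → ℝ) :=
  convexHull ℝ {x | ∃ α ∈ s, ∃ r : Fin n → ℝ, (∀ i, 0 ≤ r i) ∧ x = expR α + r}

/-- The Newton polyhedron `Γ₊(f)` of `f` at the origin. -/
def NewtonPolyhedron {n : ℕ} (f : MvPolynomial (Fin n) ℂ) : Set (Fin n → ℝ) :=
  newtonRegion {α | α ∈ f.support}

/-- The union of all bounded (nonempty, exposed) faces of `A`. -/
def boundedFacesUnion {n : ℕ} (A : Set (Fin n → ℝ)) : Set (Fin n → ℝ) :=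
  {x | ∃ F : Set (Fin n → ℝ), F.Nonempty ∧ IsExposed ℝ A F ∧
    Bornology.IsBounded F ∧ x ∈ F}

/-- The Newton boundary `Γ_f` of `f`: the union of the bounded faces of `Γ₊(f)`. -/
def NewtonBoundary {n : ℕ} (f : MvPolynomial (Fin n) ℂ) : Set (Fin n → ℝ) :=
  boundedFacesUnion (NewtonPolyhedron f)

/-- `f` is convenient: `Γ₊(f)` meets the positive part of every coordinate axis. -/
def Convenient {n : ℕ} (f : MvPolynomial (Fin n) ℂ) : Prop :=
  ∀ i : Fin n, ∃ t : ℝ, 0 < t ∧ Pi.single i t ∈ NewtonPolyhedron f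

open Classical in
/-- The part `f_F` of `f` supported on a subset `F ⊆ ℝⁿ`. -/
def faceRestrict {n : ℕ} (f : MvPolynomial (Fin n) ℂ) (F : Set (Fin n → ℝ)) :
    MvPolynomial (Fin n) ℂ :=
  ∑ α ∈ f.support.filter (fun α => expR α ∈ F), monomial α (f.coeff α)

/-- The system `g = ∂g/∂x₁ = ⋯ = ∂g/∂xₙ = 0` has a solution in `(ℂ ∖ {0})ⁿ`. -/
def hasTorusSolution {n : ℕ} (g : MvPolynomial (Fin n) ℂ) : Prop :=
  ∃ x : Fin n → ℂ, (∀ i, x i ≠ 0) ∧ eval x g = 0 ∧ ∀ i, eval x (pderiv i g) = 0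

/-- `f` is non-degenerate at `0`: for every bounded face `F` of `Γ₊(f)` the system
`f_F = ∂f_F/∂x₁ = ⋯ = ∂f_F/∂xₙ = 0` has no solution in the torus. -/
def NondegAtZero {n : ℕ} (f : MvPolynomial (Fin n) ℂ) : Prop :=
  ∀ F : Set (Fin n → ℝ), F.Nonempty → IsExposed ℝ (NewtonPolyhedron f) F →
    Bornology.IsBounded F → ¬ hasTorusSolution (faceRestrict f F)

/-- `x` is a singular point of the hypersurface `{h = 0} ⊆ ℂⁿ`. -/
def IsSingularPt {n : ℕ} (h : MvPolynomial (Fin n) ℂ) (x : Fin n → ℂ) : Prop :=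
  eval x h = 0 ∧ ∀ i, eval x (pderiv i h) = 0

open Filter Topology

/-- The pairing of a real weight vector with an exponent vector. -/
def wt {n : ℕ} (u : Fin n → ℝ) (α : Fin n →₀ ℕ) : ℝ := ∑ i, u i * (α i : ℝ)

/-- The value at `x` of the monomial with exponent `α`. -/
def monVal {n : ℕ} (x : Fin n → ℂ) (α : Fin n →₀ ℕ) : ℂ := ∏ i, x i ^ α i

lemma wt_sub {n : ℕ} (u v : Fin n → ℝ) (α : Fin n →₀ ℕ) : wt (u - v) α = wt u α - wt v α := by
  simp [wt, sub_mul, Finset.sum_sub_distrib]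

lemma abs_wt_le {n : ℕ} (u : Fin n → ℝ) (α : Fin n →₀ ℕ) :
    |wt u α| ≤ ‖u‖ * ∑ i, (α i : ℝ) := by
  rw [Finset.mul_sum]
  refine (Finset.abs_sum_le_sum_abs _ _).trans (Finset.sum_le_sum fun i _ => ?_)
  rw [abs_mul, Nat.abs_cast]
  exact mul_le_mul_of_nonneg_right (norm_le_pi_norm u i) (Nat.cast_nonneg _)

/-- The differences of weights `⟨u, α - β⟩`, as a linear function of `u`. -/
def wtDiff {n : ℕ} (D : Finset (Fin n →₀ ℕ)) (β : Fin n →₀ ℕ) :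
    (Fin n → ℝ) →ₗ[ℝ] (D → ℝ) where
  toFun u := fun α => wt u α - wt u β
  map_add' u v := by
    ext α
    simp only [wt, Pi.add_apply, add_mul, Finset.sum_add_distrib]
    ring
  map_smul' c u := by
    ext α
    simp only [wt, Pi.smul_apply, smul_eq_mul, RingHom.id_apply, mul_sub, Finset.mul_sum, mul_assoc]

lemma exists_bounded_correction {V W : Type*} [NormedAddCommGroup V] [NormedSpace ℝ V]
    [NormedAddCommGroup W] [NormedSpace ℝ W] [FiniteDimensional ℝ W] (A : V →ₗ[ℝ] W) :
    ∃ (v : V → V) (K : ℝ), 0 ≤ K ∧ ∀ u, A (u - v u) = 0 ∧ ‖v u‖ ≤ K * ‖A u‖ := by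
  obtain ⟨B, hB⟩ := A.rangeRestrict.exists_rightInverse_of_surjective A.range_rangeRestrict
  refine ⟨fun u => B (A.rangeRestrict u), ‖B.toContinuousLinearMap‖,
    ContinuousLinearMap.opNorm_nonneg _, fun u => ⟨?_, ?_⟩⟩
  · have h : A (B (A.rangeRestrict u)) = A u :=
      congrArg Subtype.val (LinearMap.congr_fun hB (A.rangeRestrict u))
    rw [map_sub, h, sub_self]
  · exact B.toContinuousLinearMap.le_opNorm (A.rangeRestrict u)

lemma Ultrafilter.tendsto_atTop_of_not_bounded {X : Type*} {U : Ultrafilter X} {g : X → ℝ}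
    (h : ¬ ∃ C, ∀ᶠ x in U, g x ≤ C) : Tendsto g U atTop := by
  refine tendsto_atTop.2 fun C => ?_
  have h' : ¬ ∀ᶠ x in U, g x ≤ C := fun hC => h ⟨C, hC⟩
  exact (Ultrafilter.eventually_not.2 h').mono fun x hx => (not_le.1 hx).le

lemma Ultrafilter.exists_eventually_min {X ι : Type*} (U : Ultrafilter X) (S : Finset ι)
    (hS : S.Nonempty) (g : X → ι → ℝ) :
    ∃ β ∈ S, ∀ᶠ x in U, ∀ α ∈ S, g x β ≤ g x α := by
  have h : ∀ᶠ x in (U : Filter X), ∃ β ∈ S, ∀ α ∈ S, g x β ≤ g x α :=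
    Eventually.of_forall fun x => S.exists_min_image (g x) hS
  exact (Ultrafilter.eventually_exists_mem_iff (S.finite_toSet)).1 h

lemma Ultrafilter.exists_tendsto_of_bounded {X : Type*} (U : Ultrafilter X) {n : ℕ}
    (y : X → Fin n → ℂ) (a b : ℝ) (ha : 0 < a)
    (h : ∀ᶠ x in U, ∀ i, a ≤ ‖y x i‖ ∧ ‖y x i‖ ≤ b) :
    ∃ z : Fin n → ℂ, (∀ i, z i ≠ 0) ∧ Tendsto y U (𝓝 z) := by
  have hK : IsCompact {y : Fin n → ℂ | ∀ i, y i ∈ {c : ℂ | a ≤ ‖c‖ ∧ ‖c‖ ≤ b}} := by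
    refine isCompact_pi_infinite fun _ => ?_
    refine (isCompact_closedBall (0 : ℂ) b).of_isClosed_subset ?_ fun c hc => by simpa using hc.2
    exact (isClosed_le continuous_const continuous_norm).inter
      (isClosed_le continuous_norm continuous_const)
  obtain ⟨z, hz, hzU⟩ := hK.ultrafilter_le_nhds (U.map y) (le_principal_iff.2 h)
  exact ⟨z, fun i hi => absurd (hz i).1 (by simpa [hi] using ha), hzU⟩

/-- Along an ultrafilter converging to the origin within the coordinate torus indexed by `I`, the
dominant monomials among `S` are cut out by a weight positive on `I`, and every linear relation
among monomials degenerates to one among the dominant monomials at a point of the torus. -/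
lemma exists_dominant_part {n : ℕ} (U : Ultrafilter (Fin n → ℂ))
    (hU : (U : Filter (Fin n → ℂ)) ≤ 𝓝 0) (I : Set (Fin n))
    (hI : ∀ i ∈ I, ∀ᶠ x : Fin n → ℂ in U, x i ≠ 0) (S : Finset (Fin n →₀ ℕ)) (hS : S.Nonempty)
    (hSI : ∀ α ∈ S, ∀ j ∉ I, α j = 0) :
    ∃ D ⊆ S, ∃ β ∈ D, ∃ (z : Fin n → ℂ) (u : Fin n → ℝ), (∀ i, z i ≠ 0) ∧
      (∀ i ∈ I, 0 < u i) ∧ (∀ α ∈ D, wt u α = wt u β) ∧ (∀ α ∈ S, α ∉ D → wt u β < wt u α) ∧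
      ∀ c : (Fin n →₀ ℕ) → ℂ, (∀ᶠ x in U, ∑ α ∈ S, c α * monVal x α = 0) →
        ∑ α ∈ D, c α * monVal z α = 0 := by
  classical
  let w : (Fin n → ℂ) → Fin n → ℝ := fun x i => -Real.log ‖x i‖
  obtain ⟨β, hβS, hβ⟩ := U.exists_eventually_min S hS fun x α => wt (w x) α
  let D := S.filter fun α => ∃ C, ∀ᶠ x in U, wt (w x) α - wt (w x) β ≤ C
  have hβD : β ∈ D := Finset.mem_filter.2 ⟨hβS, 0, by simp⟩
  obtain ⟨v, K, hK, hv⟩ := exists_bounded_correction (wtDiff D β)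
  obtain ⟨b, hb⟩ : ∃ b, ∀ᶠ x in U, ‖v (w x)‖ ≤ b := by
    have h1 : ∀ α : D, ∃ C, ∀ᶠ x in U, wt (w x) α - wt (w x) β ≤ C :=
      fun α => (Finset.mem_filter.1 α.2).2
    choose C hC using h1
    refine ⟨K * ‖C‖, ?_⟩
    filter_upwards [hβ, eventually_all.2 hC] with x hx hxC
    refine (hv (w x)).2.trans (mul_le_mul_of_nonneg_left ?_ hK)
    refine (pi_norm_le_iff_of_nonneg (norm_nonneg C)).2 fun α => ?_
    have h2 : 0 ≤ wt (w x) α - wt (w x) β :=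
      sub_nonneg.2 (hx α (Finset.mem_filter.1 α.2).1)
    change |wt (w x) α - wt (w x) β| ≤ _
    rw [abs_of_nonneg h2]
    exact (hxC α).trans ((le_abs_self _).trans (norm_le_pi_norm C α))
  let u : (Fin n → ℂ) → Fin n → ℝ := fun x => w x - v (w x)
  have huD : ∀ x, ∀ α ∈ D, wt (u x) α - wt (u x) β = 0 := fun x α hα =>
    congrFun (hv (w x)).1 ⟨α, hα⟩
  have huI : ∀ i ∈ I, Tendsto (fun x => u x i) U atTop := by
    intro i hi
    have h1 : Tendsto (fun x : Fin n → ℂ => ‖x i‖) U (𝓝[>] 0) := by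
      refine tendsto_nhdsWithin_iff.2 ⟨?_, (hI i hi).mono fun x hx => norm_pos_iff.2 hx⟩
      have : Tendsto (fun x : Fin n → ℂ => ‖x i‖) (𝓝 0) (𝓝 ‖(0 : Fin n → ℂ) i‖) :=
        (continuous_apply i).norm.tendsto 0
      simpa using this.mono_left hU
    have h2 : Tendsto (fun x : Fin n → ℂ => w x i) U atTop :=
      tendsto_neg_atBot_atTop.comp (Real.tendsto_log_nhdsGT_zero.comp h1)
    refine tendsto_atTop_mono' _ ?_ (tendsto_atTop_add_const_right _ (-b) h2)
    filter_upwards [hb] with x hx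
    have := (le_abs_self _).trans ((norm_le_pi_norm (v (w x)) i).trans hx)
    simp only [u, Pi.sub_apply]
    linarith
  have huS : ∀ α ∈ S, α ∉ D → Tendsto (fun x => wt (u x) α - wt (u x) β) U atTop := by
    intro α hα hαD
    have h1 : Tendsto (fun x => wt (w x) α - wt (w x) β) U atTop :=
      Ultrafilter.tendsto_atTop_of_not_bounded fun h => hαD (Finset.mem_filter.2 ⟨hα, h⟩)
    refine tendsto_atTop_mono' _ ?_
      (tendsto_atTop_add_const_right _ (-(b * ∑ i, (α i : ℝ) + b * ∑ i, (β i : ℝ))) h1)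
    filter_upwards [hb] with x hx
    have h2 : ∀ γ : Fin n →₀ ℕ, |wt (v (w x)) γ| ≤ b * ∑ i, (γ i : ℝ) := fun γ =>
      (abs_wt_le _ _).trans (mul_le_mul_of_nonneg_right hx (by positivity))
    have h3 := abs_le.1 (h2 α)
    have h4 := abs_le.1 (h2 β)
    simp only [u, wt_sub]
    linarith
  let y : (Fin n → ℂ) → Fin n → ℂ := fun x i => if i ∈ I then x i * (Real.exp (u x i) : ℂ) else 1
  have hIall : ∀ᶠ x : Fin n → ℂ in U, ∀ i ∈ I, x i ≠ 0 :=
    (eventually_all_finite I.toFinite).2 hI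
  obtain ⟨z, hz, hyz⟩ : ∃ z : Fin n → ℂ, (∀ i, z i ≠ 0) ∧ Tendsto y U (𝓝 z) := by
    refine U.exists_tendsto_of_bounded y (Real.exp (-b)) (Real.exp b) (Real.exp_pos _) ?_
    filter_upwards [hb, hIall] with x hx hxI i
    have hb0 : 0 ≤ b := (norm_nonneg _).trans hx
    by_cases hi : i ∈ I
    · have h1 : ‖y x i‖ = Real.exp (-(v (w x) i)) := by
        have h0 : 0 < ‖x i‖ := norm_pos_iff.2 (hxI i hi)
        simp only [y, if_pos hi, norm_mul, Complex.norm_real, Real.norm_eq_abs, Real.abs_exp]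
        conv_lhs => rw [← Real.exp_log h0]
        rw [← Real.exp_add]
        congr 1
        change Real.log ‖x i‖ + (-Real.log ‖x i‖ - v (w x) i) = _
        ring
      have h2 := abs_le.1 ((norm_le_pi_norm (v (w x)) i).trans hx)
      rw [h1]
      exact ⟨Real.exp_le_exp.2 (by linarith), Real.exp_le_exp.2 (by linarith)⟩
    · simp [y, hi, hb0]
  have hmon : ∀ x, ∀ α ∈ S, monVal x α = (Real.exp (-wt (u x) α) : ℂ) * monVal (y x) α := by
    intro x α hα
    rw [wt, ← Finset.sum_neg_distrib, Real.exp_sum, Complex.ofReal_prod, monVal, monVal,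
      ← Finset.prod_mul_distrib]
    refine Finset.prod_congr rfl fun i _ => ?_
    by_cases hi : i ∈ I
    · have h1 : Real.exp (-(u x i * (α i : ℝ))) = Real.exp (-u x i) ^ α i := by
        rw [← Real.exp_nat_mul]
        ring_nf
      simp only [y, if_pos hi]
      rw [h1, Complex.ofReal_pow, ← mul_pow, mul_left_comm, ← Complex.ofReal_mul, ← Real.exp_add]
      simp
    · simp [hSI α hα i hi]
  obtain ⟨x₀, hx₀I, hx₀S⟩ : ∃ x, (∀ i ∈ I, 0 < u x i) ∧
      ∀ α ∈ S, α ∉ D → 0 < wt (u x) α - wt (u x) β := by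
    refine Eventually.exists (f := (U : Filter (Fin n → ℂ))) (Eventually.and ?_ ?_)
    · exact (eventually_all_finite I.toFinite).2 fun i hi => (huI i hi).eventually_gt_atTop 0
    · refine (eventually_all_finset S).2 fun α hα => ?_
      by_cases hαD : α ∈ D
      · exact Eventually.of_forall fun x h => absurd hαD h
      · exact ((huS α hα hαD).eventually_gt_atTop 0).mono fun x hx _ => hx
  refine ⟨D, Finset.filter_subset _ _, β, hβD, z, u x₀, hz, hx₀I,
    fun α hα => sub_eq_zero.1 (huD x₀ α hα), fun α hα hαD => sub_pos.1 (hx₀S α hα hαD), ?_⟩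
  intro c hc
  have hmv : ∀ α, Tendsto (fun x => monVal (y x) α) U (𝓝 (monVal z α)) := fun α =>
    tendsto_finsetProd _ fun i _ => ((tendsto_pi_nhds.1 hyz) i).pow _
  have hlim : Tendsto (fun x => ∑ α ∈ S, c α *
      ((Real.exp (-(wt (u x) α - wt (u x) β)) : ℂ) * monVal (y x) α)) U
      (𝓝 (∑ α ∈ S, c α * ((if α ∈ D then 1 else 0) * monVal z α))) := by
    refine tendsto_finsetSum _ fun α hα => ((Tendsto.mul ?_ (hmv α)).const_mul _)
    by_cases hαD : α ∈ D
    · simp [huD _ α hαD, hαD]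
    · rw [if_neg hαD]
      have := Real.tendsto_exp_neg_atTop_nhds_zero.comp (huS α hα hαD)
      exact_mod_cast (Complex.continuous_ofReal.tendsto 0).comp this
  have hzero : ∀ᶠ x in U, ∑ α ∈ S, c α *
      ((Real.exp (-(wt (u x) α - wt (u x) β)) : ℂ) * monVal (y x) α) = 0 := by
    filter_upwards [hc] with x hx
    have h1 : ∑ α ∈ S, c α * ((Real.exp (-(wt (u x) α - wt (u x) β)) : ℂ) * monVal (y x) α)
        = (Real.exp (wt (u x) β) : ℂ) * ∑ α ∈ S, c α * monVal x α := by
      rw [Finset.mul_sum]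
      refine Finset.sum_congr rfl fun α hα => ?_
      rw [hmon x α hα, neg_sub, sub_eq_add_neg, Real.exp_add]
      push_cast
      ring
    rw [h1, hx, mul_zero]
  have h0 := tendsto_nhds_unique (hlim.congr' hzero) tendsto_const_nhds
  have hDS : D ⊆ S := Finset.filter_subset _ _
  rw [← h0, ← Finset.sum_subset hDS]
  · exact Finset.sum_congr rfl fun α hα => by simp [hα]
  · intro α _ hα
    simp [hα]

lemma exists_weight_extension {n : ℕ} (I : Set (Fin n))
    (β : Fin n →₀ ℕ) (hβ : ∀ j ∉ I, β j = 0) (u : Fin n → ℝ) (hu : ∀ i ∈ I, 0 < u i) :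
    ∃ W : Fin n → ℝ, (∀ i, 0 < W i) ∧
      (∀ α : Fin n →₀ ℕ, (∀ j ∉ I, α j = 0) → wt W α = wt u α) ∧
      ∀ α : Fin n →₀ ℕ, (∃ j ∉ I, α j ≠ 0) → wt W β < wt W α := by
  classical
  let W : Fin n → ℝ := fun i => if i ∈ I then u i else |wt u β| + 1
  have hW : ∀ i, 0 < W i := fun i => by
    by_cases hi : i ∈ I
    · simpa [W, hi] using hu i hi
    · simp only [W, if_neg hi]
      positivity
  have hWu : ∀ α : Fin n →₀ ℕ, (∀ j ∉ I, α j = 0) → wt W α = wt u α := fun α hα => by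
    refine Finset.sum_congr rfl fun i _ => ?_
    by_cases hi : i ∈ I
    · simp [W, hi]
    · simp [hα i hi]
  refine ⟨W, hW, hWu, ?_⟩
  rintro α ⟨j, hj, hαj⟩
  rw [hWu β hβ]
  calc wt u β < W j := by
        simp only [W, if_neg hj]
        linarith [le_abs_self (wt u β)]
    _ ≤ W j * (α j : ℝ) :=
        le_mul_of_one_le_right (hW j).le (by exact_mod_cast Nat.one_le_iff_ne_zero.2 hαj)
    _ ≤ wt W α := Finset.single_le_sum (f := fun i => W i * (α i : ℝ))
        (fun i _ => mul_nonneg (hW i).le (Nat.cast_nonneg _)) (Finset.mem_univ j)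

lemma expR_mem_newtonPolyhedron {n : ℕ} {f : MvPolynomial (Fin n) ℂ} {α : Fin n →₀ ℕ}
    (hα : α ∈ f.support) : expR α ∈ NewtonPolyhedron f :=
  subset_convexHull ℝ _ ⟨α, hα, 0, by simp, by simp⟩

/-- A linear lower bound valid at the exponents of `f`, with nonnegative weights, holds on the
Newton polyhedron. -/
lemma le_of_mem_newtonPolyhedron {n : ℕ} {f : MvPolynomial (Fin n) ℂ} {W : Fin n → ℝ}
    (hW : ∀ i, 0 ≤ W i) {m : ℝ} (hm : ∀ α ∈ f.support, m ≤ wt W α) {x : Fin n → ℝ}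
    (hx : x ∈ NewtonPolyhedron f) : m ≤ ∑ i, W i * x i := by
  have hconv : Convex ℝ {x : Fin n → ℝ | m ≤ ∑ i, W i * x i} :=
    convex_halfSpace_ge
      ⟨fun x y => by simp [mul_add, Finset.sum_add_distrib],
        fun c x => by simp [Finset.mul_sum, mul_left_comm]⟩ m
  refine convexHull_min ?_ hconv hx
  rintro _ ⟨α, hα, r, hr, rfl⟩
  have h1 : 0 ≤ ∑ i, W i * r i := Finset.sum_nonneg fun i _ => mul_nonneg (hW i) (hr i)
  have h2 : ∑ i, W i * (expR α + r) i = wt W α + ∑ i, W i * r i := by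
    simp [wt, expR, mul_add, Finset.sum_add_distrib]
  have h3 := hm α hα
  simp only [Set.mem_ofPred_eq, h2]
  linarith

lemma nonneg_of_mem_newtonPolyhedron {n : ℕ} {f : MvPolynomial (Fin n) ℂ} {x : Fin n → ℝ}
    (hx : x ∈ NewtonPolyhedron f) (i : Fin n) : 0 ≤ x i := by
  classical
  have h := le_of_mem_newtonPolyhedron (W := Pi.single i 1) (m := 0)
    (fun j => by by_cases h : j = i <;> simp [h])
    (fun α _ => by simp [wt, Pi.single_apply]) hx
  simpa [Pi.single_apply] using h

/-- A positive weight defines a bounded exposed face of the Newton polyhedron. -/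
lemma exists_face_of_weight {n : ℕ} {f : MvPolynomial (Fin n) ℂ} {W : Fin n → ℝ}
    (hW : ∀ i, 0 < W i) {β : Fin n →₀ ℕ} (hβ : β ∈ f.support)
    (hmin : ∀ α ∈ f.support, wt W β ≤ wt W α) :
    ∃ F : Set (Fin n → ℝ), F.Nonempty ∧ IsExposed ℝ (NewtonPolyhedron f) F ∧
      Bornology.IsBounded F ∧ ∀ α ∈ f.support, expR α ∈ F ↔ wt W α = wt W β := by
  let l : (Fin n → ℝ) →ₗ[ℝ] ℝ :=
    { toFun := fun x => -∑ i, W i * x i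
      map_add' := fun x y => by simp [mul_add, Finset.sum_add_distrib, add_comm]
      map_smul' := fun c x => by simp [Finset.mul_sum, mul_left_comm] }
  have hl : ∀ x, l x = -∑ i, W i * x i := fun _ => rfl
  let F := {x ∈ NewtonPolyhedron f | ∀ y ∈ NewtonPolyhedron f, l y ≤ l x}
  have hle : ∀ x ∈ NewtonPolyhedron f, wt W β ≤ ∑ i, W i * x i := fun x hx =>
    le_of_mem_newtonPolyhedron (fun i => (hW i).le) hmin hx
  have hF : ∀ x, x ∈ F ↔ x ∈ NewtonPolyhedron f ∧ ∑ i, W i * x i = wt W β := by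
    refine fun x => and_congr_right fun hx => ⟨fun h => ?_, fun h y hy => ?_⟩
    · have h1 := h _ (expR_mem_newtonPolyhedron hβ)
      rw [hl, hl, neg_le_neg_iff] at h1
      exact le_antisymm h1 (hle x hx)
    · rw [hl, hl, neg_le_neg_iff, h]
      exact hle y hy
  refine ⟨F, ⟨expR β, (hF _).2 ⟨expR_mem_newtonPolyhedron hβ, rfl⟩⟩,
    fun _ => ⟨l.toContinuousLinearMap, rfl⟩, ?_, fun α hα => ?_⟩
  · refine (Metric.isBounded_Icc (0 : Fin n → ℝ) fun i => wt W β / W i).subset fun x hx => ?_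
    obtain ⟨hx, hxβ⟩ := (hF x).1 hx
    have h0 := nonneg_of_mem_newtonPolyhedron hx
    refine ⟨h0, fun i => (le_div_iff₀ (hW i)).2 ?_⟩
    rw [← hxβ, mul_comm]
    exact Finset.single_le_sum (f := fun i => W i * x i)
      (fun i _ => mul_nonneg (hW i).le (h0 i)) (Finset.mem_univ i)
  · rw [hF]
    exact and_iff_right (expR_mem_newtonPolyhedron hα)

/-- A convenient polynomial has an exponent on each coordinate axis. -/
lemma Convenient.exists_mem_support {n : ℕ} {f : MvPolynomial (Fin n) ℂ} (hf : Convenient f)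
    (i : Fin n) : ∃ α ∈ f.support, ∀ j ≠ i, α j = 0 := by
  obtain ⟨t, -, ht⟩ := hf i
  by_contra! h
  let W : Fin n → ℝ := fun j => if j = i then 0 else 1
  have hW : ∀ j, 0 ≤ W j := fun j => by by_cases hj : j = i <;> simp [W, hj]
  have h1 : (1 : ℝ) ≤ ∑ j, W j * (Pi.single i t : Fin n → ℝ) j := by
    refine le_of_mem_newtonPolyhedron hW (fun α hα => ?_) ht
    obtain ⟨j, hj, hαj⟩ := h α hα
    calc (1 : ℝ) ≤ W j * (α j : ℝ) := by
          simpa [W, hj] using Nat.one_le_iff_ne_zero.2 hαj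
      _ ≤ wt W α := Finset.single_le_sum (f := fun i => W i * (α i : ℝ))
          (fun i _ => mul_nonneg (hW i) (Nat.cast_nonneg _)) (Finset.mem_univ j)
  have h2 : ∑ j, W j * (Pi.single i t : Fin n → ℝ) j = 0 :=
    Finset.sum_eq_zero fun j _ => by by_cases hj : j = i <;> simp [W, hj]
  linarith

lemma eval_sum_monomial {n : ℕ} (T : Finset (Fin n →₀ ℕ)) (c : (Fin n →₀ ℕ) → ℂ)
    (x : Fin n → ℂ) : eval x (∑ α ∈ T, monomial α (c α)) = ∑ α ∈ T, c α * monVal x α := by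
  rw [map_sum]
  refine Finset.sum_congr rfl fun α _ => ?_
  rw [eval_monomial, monVal, Finsupp.prod_fintype _ _ fun i => pow_zero _]

lemma mul_eval_pderiv_sum_monomial {n : ℕ} (T : Finset (Fin n →₀ ℕ)) (c : (Fin n →₀ ℕ) → ℂ)
    (x : Fin n → ℂ) (i : Fin n) :
    x i * eval x (pderiv i (∑ α ∈ T, monomial α (c α))) =
      ∑ α ∈ T, ((α i : ℂ) * c α) * monVal x α := by
  have h : X i * pderiv i (∑ α ∈ T, monomial α (c α)) =
      ∑ α ∈ T, monomial α ((α i : ℂ) * c α) := by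
    rw [map_sum, Finset.mul_sum]
    refine Finset.sum_congr rfl fun α _ => ?_
    rw [X_mul_pderiv_monomial, smul_monomial, nsmul_eq_mul]
  rw [← eval_sum_monomial, ← h, map_mul, eval_X]

/-- No ultrafilter converging to the origin concentrates on the nonzero singular points of a
convenient polynomial that is non-degenerate at the origin. -/
lemma NondegAtZero.not_eventually_isSingularPt {n : ℕ} {f : MvPolynomial (Fin n) ℂ}
    (hconv : Convenient f) (hnd : NondegAtZero f) (U : Ultrafilter (Fin n → ℂ))
    (hU : (U : Filter (Fin n → ℂ)) ≤ 𝓝 0)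
    (hne : ∀ᶠ x : Fin n → ℂ in U, x ≠ 0) (hsing : ∀ᶠ x in U, IsSingularPt f x) : False := by
  classical
  let I : Set (Fin n) := {i | ∀ᶠ x : Fin n → ℂ in U, x i ≠ 0}
  have hIc : ∀ᶠ x : Fin n → ℂ in U, ∀ j ∉ I, x j = 0 :=
    (eventually_all_finite (Set.toFinite Iᶜ)).2 fun j hj =>
      (Ultrafilter.eventually_not.2 hj).mono fun x hx => not_not.1 hx
  obtain ⟨i, hi⟩ : I.Nonempty := by
    obtain ⟨x, hx, hxI⟩ := (hne.and hIc).exists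
    obtain ⟨i, hi⟩ := Function.ne_iff.1 hx
    exact ⟨i, by_contra fun h => hi (hxI i h)⟩
  let S := f.support.filter fun α => ∀ j ∉ I, α j = 0
  have hS : S.Nonempty := by
    obtain ⟨α, hα, h⟩ := hconv.exists_mem_support i
    exact ⟨α, Finset.mem_filter.2 ⟨hα, fun j hj => h j fun e => hj (e ▸ hi)⟩⟩
  have hSI : ∀ α ∈ S, ∀ j ∉ I, α j = 0 := fun α hα => (Finset.mem_filter.1 hα).2
  obtain ⟨D, hDS, β, hβD, z, u, hz, hu, huD, huS, hrel⟩ :=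
    exists_dominant_part U hU I (fun i hi => hi) S hS hSI
  have hrel' : ∀ c : (Fin n →₀ ℕ) → ℂ, (∀ᶠ x in U, ∑ α ∈ f.support, c α * monVal x α = 0) →
      ∑ α ∈ D, c α * monVal z α = 0 := by
    refine fun c hc => hrel c ?_
    filter_upwards [hc, hIc] with x hx hxI
    rw [← hx]
    refine Finset.sum_subset (Finset.filter_subset _ _) fun α hα hαS => ?_
    obtain ⟨j, hj, hαj⟩ : ∃ j ∉ I, α j ≠ 0 := by
      by_contra! h
      exact hαS (Finset.mem_filter.2 ⟨hα, h⟩)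
    rw [monVal, Finset.prod_eq_zero (Finset.mem_univ j), mul_zero]
    rw [hxI j hj, zero_pow hαj]
  obtain ⟨W, hW, hWu, hWlt⟩ := exists_weight_extension I β (hSI β (hDS hβD)) u hu
  have hlt : ∀ α ∈ f.support, α ∉ D → wt W β < wt W α := fun α hα hαD => by
    by_cases hαS : ∀ j ∉ I, α j = 0
    · rw [hWu α hαS, hWu β (hSI β (hDS hβD))]
      exact huS α (Finset.mem_filter.2 ⟨hα, hαS⟩) hαD
    · push Not at hαS
      exact hWlt α hαS
  have heq : ∀ α ∈ D, wt W α = wt W β := fun α hα => by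
    rw [hWu α (hSI α (hDS hα)), hWu β (hSI β (hDS hβD)), huD α hα]
  have hDf : D ⊆ f.support := hDS.trans (Finset.filter_subset _ _)
  obtain ⟨F, hFne, hFexp, hFbdd, hF⟩ := exists_face_of_weight hW (hDf hβD) fun α hα => by
    by_cases hαD : α ∈ D
    · exact (heq α hαD).ge
    · exact (hlt α hα hαD).le
  have hface : faceRestrict f F = ∑ α ∈ D, monomial α (f.coeff α) := by
    refine Finset.sum_congr ?_ fun _ _ => rfl
    ext α
    rw [Finset.mem_filter]
    refine ⟨fun ⟨hα, h⟩ => ?_, fun h => ⟨hDf h, (hF α (hDf h)).2 (heq α h)⟩⟩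
    by_contra hαD
    exact (hlt α hα hαD).ne' ((hF α hα).1 h)
  refine hnd F hFne hFexp hFbdd ⟨z, hz, ?_, fun i => ?_⟩
  · rw [hface, eval_sum_monomial]
    refine hrel' _ (hsing.mono fun x hx => ?_)
    rw [← eval_sum_monomial, support_sum_monomial_coeff]
    exact hx.1
  · refine (mul_eq_zero.1 ?_).resolve_left (hz i)
    rw [hface, mul_eval_pderiv_sum_monomial]
    refine hrel' _ (hsing.mono fun x hx => ?_)
    rw [← mul_eval_pderiv_sum_monomial, support_sum_monomial_coeff, hx.2 i, mul_zero]

/-- If `f` is a non-constant polynomial with `f(0) = 0` which is convenient and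
non-degenerate at `0`, then `0` is a smooth or isolated singular point of `{f = 0}`:
there is an open neighborhood `U` of `0` containing no singular point other than
possibly `0` itself. -/
theorem stmt0 (n : ℕ) (hn : 2 ≤ n) (f : MvPolynomial (Fin n) ℂ)
    (hfnc : ¬ ∃ c : ℂ, f = C c) (hf0 : eval (0 : Fin n → ℂ) f = 0)
    (hconv : Convenient f) (hnd : NondegAtZero f) :
    ∃ U : Set (Fin n → ℂ), IsOpen U ∧ (0 : Fin n → ℂ) ∈ U ∧
      ∀ x ∈ U, x ≠ 0 → ¬ IsSingularPt f x := by
  have h : ∀ᶠ x in 𝓝 (0 : Fin n → ℂ), x ≠ 0 → ¬ IsSingularPt f x := by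
    by_contra h
    have h' : ∃ᶠ x in 𝓝 (0 : Fin n → ℂ), x ≠ 0 ∧ IsSingularPt f x :=
      (not_eventually.1 h).mono fun x hx => by push Not at hx; exact hx
    have := frequently_iff_neBot.1 h'
    let U := Ultrafilter.of (𝓝 (0 : Fin n → ℂ) ⊓ 𝓟 {x | x ≠ 0 ∧ IsSingularPt f x})
    have hU := Ultrafilter.of_le (𝓝 (0 : Fin n → ℂ) ⊓ 𝓟 {x | x ≠ 0 ∧ IsSingularPt f x})
    have hmem : ∀ᶠ x in U, x ≠ 0 ∧ IsSingularPt f x := hU (mem_inf_of_right (mem_principal_self _))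
    exact hnd.not_eventually_isSingularPt hconv U (hU.trans inf_le_left) (hmem.mono fun _ hx => hx.1)
      (hmem.mono fun _ hx => hx.2)
  obtain ⟨U, hU, hUo, h0⟩ := eventually_nhds_iff.1 h
  exact ⟨U, hUo, h0, hU⟩
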